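/- arXiv:2406.05758 — 7 statements merged into one kernel-verified Lean document; each statement's English description precedes it below -/
import Mathlib

section
/- Let G be an S_{3,3}-free simple graph and let u, v be adjacent vertices with d(u) ≥ 4 and d(v) ≥ 4. Then u and v have at least d(u) + d(v) − 7 common neighbors, i.e. |N(u) ∩ N(v)| ≥ d(u) + d(v) − 7. -/
/-- A simple graph `G` contains the double star `S_{m,l}`: there are adjacent vertices
`x, y` and disjoint sets `A ⊆ N(x) \\ {y}`, `B ⊆ N(y) \\ {x}` with `|A| = m`, `|B| = l`
and `x, y ∉ A ∪ B`. -/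
def ContainsDoubleStar {V : Type*} (G : SimpleGraph V) (m l : ℕ) : Prop :=
  ∃ x y : V, ∃ A B : Finset V,
    G.Adj x y ∧
    (∀ a ∈ A, G.Adj x a ∧ a ≠ y) ∧
    (∀ b ∈ B, G.Adj y b ∧ b ≠ x) ∧
    A.card = m ∧ B.card = l ∧ Disjoint A B ∧
    x ∉ A ∧ x ∉ B ∧ y ∉ A ∧ y ∉ B

/-- If two finite sets of sizes at least `m` and `l` have a union of size at least `m + l`, then
they contain disjoint subsets of sizes `m` and `l` respectively. -/
theorem Finset.exists_disjoint_subsets_card_eq {α : Type*} [DecidableEq α] {S T : Finset α}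
    {m l : ℕ} (hS : m ≤ S.card) (hT : l ≤ T.card) (hST : m + l ≤ (S ∪ T).card) :
    ∃ A ⊆ S, ∃ B ⊆ T, A.card = m ∧ B.card = l ∧ Disjoint A B := by
  rcases le_total m (S \ T).card with h | h
  · obtain ⟨A, hA, hAm⟩ := Finset.exists_subset_card_eq h
    obtain ⟨B, hB, hBl⟩ := Finset.exists_subset_card_eq hT
    exact ⟨A, hA.trans Finset.sdiff_subset, B, hB, hAm, hBl,
      Finset.disjoint_of_subset_left hA
        (Finset.disjoint_of_subset_right hB Finset.sdiff_disjoint)⟩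
  · obtain ⟨A, hA, hAS, hAm⟩ := Finset.exists_subsuperset_card_eq Finset.sdiff_subset h hS
    have hunion : S ∪ T ⊆ A ∪ T \ A := by
      intro x hx
      have := @hA x
      simp only [Finset.mem_union, Finset.mem_sdiff] at *
      tauto
    have hcard : l ≤ (T \ A).card := by
      have := (Finset.card_le_card hunion).trans (Finset.card_union_le _ _)
      omega
    obtain ⟨B, hB, hBl⟩ := Finset.exists_subset_card_eq hcard
    exact ⟨A, hAS, B, hB.trans Finset.sdiff_subset, hAm, hBl,
      Finset.disjoint_of_subset_right hB Finset.disjoint_sdiff⟩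

theorem stmt_2 {V : Type*} [Fintype V] [DecidableEq V] (G : SimpleGraph V)
    [DecidableRel G.Adj] (hfree : ¬ ContainsDoubleStar G 3 3) (u v : V)
    (huv : G.Adj u v) (hu : 4 ≤ G.degree u) (hv : 4 ≤ G.degree v) :
    G.degree u + G.degree v - 7 ≤ (G.neighborFinset u ∩ G.neighborFinset v).card := by
  set S := (G.neighborFinset u).erase v with hS
  set T := (G.neighborFinset v).erase u with hT
  have hScard : S.card = G.degree u - 1 := by
    rw [hS, Finset.card_erase_of_mem (by simpa using huv), G.card_neighborFinset_eq_degree]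
  have hTcard : T.card = G.degree v - 1 := by
    rw [hT, Finset.card_erase_of_mem (by simpa using huv.symm), G.card_neighborFinset_eq_degree]
  have hinter : (S ∩ T).card ≤ (G.neighborFinset u ∩ G.neighborFinset v).card :=
    Finset.card_le_card
      (Finset.inter_subset_inter (Finset.erase_subset _ _) (Finset.erase_subset _ _))
  have hadd := Finset.card_union_add_card_inter S T
  by_contra! hlt
  obtain ⟨A, hA, B, hB, hA3, hB3, hAB⟩ :=
    Finset.exists_disjoint_subsets_card_eq (S := S) (T := T) (m := 3) (l := 3)
      (by omega) (by omega) (by omega)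
  have hA' : ∀ a ∈ A, G.Adj u a ∧ a ≠ v := fun a ha => by
    simpa [hS, and_comm] using hA ha
  have hB' : ∀ b ∈ B, G.Adj v b ∧ b ≠ u := fun b hb => by
    simpa [hT, and_comm] using hB hb
  exact hfree ⟨u, v, A, B, huv, hA', hB', hA3, hB3, hAB,
    fun h => G.irrefl (hA' u h).1, fun h => (hB' u h).2 rfl,
    fun h => (hA' v h).2 rfl, fun h => G.irrefl (hB' v h).1⟩
end

section
/- Let G be an S_{3,3}-free simple graph and let u, v be adjacent vertices with d(u) ≥ 6 and d(v) ≥ 4 (a 6-4 edge). Then there are at least 3 triangles sitting on the edge uv, i.e. |N(u) ∩ N(v)| ≥ 3. -/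
theorem stmt_5 {V : Type*} [Fintype V] [DecidableEq V] (G : SimpleGraph V)
    [DecidableRel G.Adj] (hfree : ¬ ContainsDoubleStar G 3 3) (u v : V)
    (huv : G.Adj u v) (hu : 6 ≤ G.degree u) (hv : 4 ≤ G.degree v) :
    3 ≤ (G.neighborFinset u ∩ G.neighborFinset v).card := by
  by_contra! h
  have hP : 5 ≤ ((G.neighborFinset u).erase v).card := by
    rw [Finset.card_erase_of_mem (by simpa using huv), G.card_neighborFinset_eq_degree]
    omega
  have hQ : 3 ≤ ((G.neighborFinset v).erase u).card := by
    rw [Finset.card_erase_of_mem (by simpa using huv.symm), G.card_neighborFinset_eq_degree]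
    omega
  obtain ⟨B, hB, hBc⟩ := Finset.exists_subset_card_eq hQ
  have hBP : (((G.neighborFinset u).erase v) ∩ B).card ≤ 2 := by
    refine (Finset.card_le_card ?_).trans (Nat.le_of_lt_succ h)
    exact Finset.inter_subset_inter (Finset.erase_subset _ _)
      (hB.trans (Finset.erase_subset _ _))
  have hPB : 3 ≤ (((G.neighborFinset u).erase v) \ B).card := by
    have := Finset.card_sdiff_add_card_inter ((G.neighborFinset u).erase v) B
    omega
  obtain ⟨A, hA, hAc⟩ := Finset.exists_subset_card_eq hPB
  have hA' : ∀ a ∈ A, G.Adj u a ∧ a ≠ v := fun a ha ↦ by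
    have := hA ha
    simp only [Finset.mem_sdiff, Finset.mem_erase, SimpleGraph.mem_neighborFinset] at this
    exact ⟨this.1.2, this.1.1⟩
  have hB' : ∀ b ∈ B, G.Adj v b ∧ b ≠ u := fun b hb ↦ by
    simpa [and_comm] using hB hb
  exact hfree ⟨u, v, A, B, huv, hA', hB', hAc, hBc,
    Finset.disjoint_of_subset_left hA Finset.sdiff_disjoint,
    fun h ↦ G.irrefl (hA' u h).1, fun h ↦ (hB' u h).2 rfl,
    fun h ↦ (hA' v h).2 rfl, fun h ↦ G.irrefl (hB' v h).1⟩
end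

section
/- Let G be an S_{3,3}-free simple graph and let u, v be adjacent vertices with d(u) ≥ 5 and d(v) ≥ 4 (a 5-4 edge). Then there are at least 2 triangles sitting on the edge uv, i.e. |N(u) ∩ N(v)| ≥ 2. -/
theorem stmt_7 {V : Type*} [Fintype V] [DecidableEq V] (G : SimpleGraph V)
    [DecidableRel G.Adj] (hfree : ¬ ContainsDoubleStar G 3 3) (u v : V)
    (huv : G.Adj u v) (hu : 5 ≤ G.degree u) (hv : 4 ≤ G.degree v) :
    2 ≤ (G.neighborFinset u ∩ G.neighborFinset v).card := by
  by_contra! h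
  have hvu : 3 ≤ ((G.neighborFinset v).erase u).card := by
    rw [Finset.card_erase_of_mem (by simpa using huv.symm), G.card_neighborFinset_eq_degree]
    omega
  obtain ⟨B, hB, hBcard⟩ := Finset.exists_subset_card_eq hvu
  have hinter : (B ∩ (G.neighborFinset u).erase v).card ≤ 1 := by
    refine (Finset.card_le_card fun x hx => ?_).trans (Nat.le_of_lt_succ h)
    rw [Finset.mem_inter] at hx ⊢
    exact ⟨Finset.mem_of_mem_erase hx.2, Finset.mem_of_mem_erase (hB hx.1)⟩
  have huB : 3 ≤ ((G.neighborFinset u).erase v \ B).card := by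
    rw [Finset.card_sdiff, Finset.card_erase_of_mem (by simpa using huv),
      G.card_neighborFinset_eq_degree]
    omega
  obtain ⟨A, hA, hAcard⟩ := Finset.exists_subset_card_eq huB
  have hA' : ∀ a ∈ A, G.Adj u a ∧ a ≠ v := fun a ha => by
    have := hA ha
    simp only [Finset.mem_sdiff, Finset.mem_erase, G.mem_neighborFinset] at this
    exact ⟨this.1.2, this.1.1⟩
  have hB' : ∀ b ∈ B, G.Adj v b ∧ b ≠ u := fun b hb => by
    have := hB hb
    simp only [Finset.mem_erase, G.mem_neighborFinset] at this
    exact this.symm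
  exact hfree ⟨u, v, A, B, huv, hA', hB', hAcard, hBcard,
    Finset.disjoint_of_subset_left hA Finset.sdiff_disjoint,
    fun hm => (hA' u hm).1.ne rfl, fun hm => (hB' u hm).2 rfl,
    fun hm => (hA' v hm).2 rfl, fun hm => (hB' v hm).1.ne rfl⟩
end

section
/- Let G be an S_{3,3}-free simple graph, let u, v be adjacent vertices with d(u) = d(v) = 6, and let x be a common neighbor of u and v. Then x has at most one neighbor outside the set {u, v} ∪ (N(u) ∩ N(v)). -/
open Finset in
/-- If `G` is `S_{3,3}`-free and `u`, `v` are adjacent vertices of degree at least `6`, then every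
neighbor of `u` other than `v` is a neighbor of `v`. -/
theorem adj_of_not_containsDoubleStar {V : Type*} [Fintype V] [DecidableEq V] (G : SimpleGraph V)
    [DecidableRel G.Adj] (hfree : ¬ ContainsDoubleStar G 3 3) {u v w : V}
    (huv : G.Adj u v) (hu : 6 ≤ G.degree u) (hv : 6 ≤ G.degree v)
    (hw : G.Adj u w) (hwv : w ≠ v) : G.Adj v w := by
  by_contra hvw
  have hA : 2 ≤ (((G.neighborFinset u).erase v).erase w).card := by
    rw [card_erase_of_mem (by simp [hw, hwv]), card_erase_of_mem (by simp [huv]),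
      G.card_neighborFinset_eq_degree]
    omega
  obtain ⟨A, hAsub, hAcard⟩ := exists_subset_card_eq hA
  have hA' : ∀ a ∈ A, a ≠ w ∧ a ≠ v ∧ G.Adj u a := fun a ha => by simpa using hAsub ha
  have hB : 3 ≤ ((G.neighborFinset v).erase u \ A).card := by
    have h := le_card_sdiff A ((G.neighborFinset v).erase u)
    rw [card_erase_of_mem (by simp [huv.symm]), G.card_neighborFinset_eq_degree] at h
    omega
  obtain ⟨B, hBsub, hBcard⟩ := exists_subset_card_eq hB
  have hB' : ∀ b ∈ B, (b ≠ u ∧ G.Adj v b) ∧ b ∉ A := fun b hb => by simpa using hBsub hb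
  refine hfree ⟨u, v, insert w A, B, huv, ?_, fun b hb => ⟨(hB' b hb).1.2, (hB' b hb).1.1⟩,
    ?_, hBcard, ?_, ?_, fun h => (hB' u h).1.1 rfl, ?_, fun h => G.irrefl (hB' v h).1.2⟩
  · intro a ha
    obtain rfl | ha := mem_insert.1 ha
    · exact ⟨hw, hwv⟩
    · exact ⟨(hA' a ha).2.2, (hA' a ha).2.1⟩
  · rw [card_insert_of_notMem fun h => (hA' w h).1 rfl, hAcard]
  · rw [disjoint_insert_left]
    exact ⟨fun h => hvw (hB' w h).1.2, disjoint_right.2 fun b hb => (hB' b hb).2⟩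
  · rw [mem_insert, not_or]
    exact ⟨hw.ne, fun h => G.irrefl (hA' u h).2.2⟩
  · rw [mem_insert, not_or]
    exact ⟨hwv.symm, fun h => (hA' v h).2.1 rfl⟩

theorem stmt_8 {V : Type*} [Fintype V] [DecidableEq V] (G : SimpleGraph V)
    [DecidableRel G.Adj] (hfree : ¬ ContainsDoubleStar G 3 3) (u v x : V)
    (huv : G.Adj u v) (hu : G.degree u = 6) (hv : G.degree v = 6)
    (hxu : G.Adj u x) (hxv : G.Adj v x) :
    (G.neighborFinset x \ ({u, v} ∪ (G.neighborFinset u ∩ G.neighborFinset v))).card ≤ 1 := by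
  by_contra! hcard
  obtain ⟨a, ha, b, hb, hab⟩ := Finset.one_lt_card.1 hcard
  have hout : ∀ c ∈ G.neighborFinset x \ ({u, v} ∪ (G.neighborFinset u ∩ G.neighborFinset v)),
      G.Adj x c ∧ c ≠ u ∧ c ≠ v ∧ ¬ G.Adj u c := by
    intro c hc
    simp only [Finset.mem_sdiff, Finset.mem_union, Finset.mem_insert, Finset.mem_singleton,
      Finset.mem_inter, SimpleGraph.mem_neighborFinset, not_or, not_and] at hc
    obtain ⟨hxc, ⟨hcu, hcv⟩, hc⟩ := hc
    exact ⟨hxc, hcu, hcv, fun h => hc h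
      (adj_of_not_containsDoubleStar G hfree huv hu.ge hv.ge h hcv)⟩
  obtain ⟨hxa, hau, hav, hua⟩ := hout a ha
  obtain ⟨hxb, hbu, hbv, hub⟩ := hout b hb
  have hB : 3 ≤ (((G.neighborFinset u).erase v).erase x).card := by
    rw [Finset.card_erase_of_mem (by simp [hxu, hxv.ne']), Finset.card_erase_of_mem (by simp [huv]),
      G.card_neighborFinset_eq_degree]
    omega
  obtain ⟨B, hBsub, hBcard⟩ := Finset.exists_subset_card_eq hB
  have hB' : ∀ c ∈ B, c ≠ x ∧ c ≠ v ∧ G.Adj u c := fun c hc => by simpa using hBsub hc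
  refine hfree ⟨x, u, {a, b, v}, B, hxu.symm, ?_, fun c hc => ⟨(hB' c hc).2.2, (hB' c hc).1⟩,
    Finset.card_eq_three.2 ⟨a, b, v, hab, hav, hbv, rfl⟩, hBcard, ?_, ?_,
    fun h => (hB' x h).1 rfl, ?_, fun h => G.irrefl (hB' u h).2.2⟩
  · simp [hxa, hxb, hxv.symm, hau, hbu, huv.ne']
  · simp only [Finset.disjoint_insert_left, Finset.disjoint_singleton_left]
    exact ⟨fun h => hua (hB' a h).2.2, fun h => hub (hB' b h).2.2, fun h => (hB' v h).2.1 rfl⟩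
  · simp [hxa.ne, hxb.ne, hxv.ne']
  · simp [hau.symm, hbu.symm, huv.ne]
end

section
/- Let G be an S_{3,3}-free simple graph, let u, v be adjacent vertices with d(u) = d(v) = 6, and let x be a common neighbor of u and v with d(x) = 4. Then x has no neighbor outside the set {u, v} ∪ (N(u) ∩ N(v)), i.e. N(x) ⊆ {u, v} ∪ (N(u) ∩ N(v)). -/
theorem Finset.exists_disjoint_subsets_card_eq_s9 {α : Type*} [DecidableEq α] {s t : Finset α}
    {m l : ℕ} (hs : m ≤ s.card) (ht : l ≤ t.card) (hst : m + l ≤ (s ∪ t).card) :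
    ∃ a ⊆ s, ∃ b ⊆ t, a.card = m ∧ b.card = l ∧ Disjoint a b := by
  rcases le_total l (t \ s).card with h | h
  · obtain ⟨a, ha, hac⟩ := Finset.exists_subset_card_eq hs
    obtain ⟨b, hb, hbc⟩ := Finset.exists_subset_card_eq h
    exact ⟨a, ha, b, hb.trans Finset.sdiff_subset, hac, hbc,
      Finset.disjoint_sdiff.mono ha hb⟩
  · obtain ⟨b, hsub, hb, hbc⟩ :=
      Finset.exists_subsuperset_card_eq (Finset.sdiff_subset (s := t) (t := s)) h ht
    have hle : (s ∪ t).card ≤ (s \ b).card + b.card := by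
      refine (Finset.card_le_card fun x hx => ?_).trans (Finset.card_union_le _ _)
      have := @hsub x
      simp only [Finset.mem_union, Finset.mem_sdiff] at *
      tauto
    obtain ⟨a, ha, hac⟩ := Finset.exists_subset_card_eq (n := m) (s := s \ b) (by omega)
    exact ⟨a, ha.trans Finset.sdiff_subset, b, hb, hac, hbc,
      Finset.sdiff_disjoint.mono_left ha⟩

theorem containsDoubleStar_of_card_union {V : Type*} [Fintype V] [DecidableEq V]
    {G : SimpleGraph V} [DecidableRel G.Adj] {m l : ℕ} {x y : V} (hxy : G.Adj x y)
    (hx : m + 1 ≤ G.degree x) (hy : l + 1 ≤ G.degree y)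
    (h : m + l ≤ ((G.neighborFinset x).erase y ∪ (G.neighborFinset y).erase x).card) :
    ContainsDoubleStar G m l := by
  have hxc : m ≤ ((G.neighborFinset x).erase y).card := by
    rw [Finset.card_erase_of_mem (by simpa using hxy), G.card_neighborFinset_eq_degree]
    omega
  have hyc : l ≤ ((G.neighborFinset y).erase x).card := by
    rw [Finset.card_erase_of_mem (by simpa using hxy.symm), G.card_neighborFinset_eq_degree]
    omega
  obtain ⟨A, hA, B, hB, hAc, hBc, hAB⟩ := Finset.exists_disjoint_subsets_card_eq_s9 hxc hyc h
  refine ⟨x, y, A, B, hxy, fun a ha => ?_, fun b hb => ?_, hAc, hBc, hAB, fun hm => ?_,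
    fun hm => ?_, fun hm => ?_, fun hm => ?_⟩
  · simpa [and_comm] using hA ha
  · simpa [and_comm] using hB hb
  · simpa using hA hm
  · simpa using hB hm
  · simpa using hA hm
  · simpa using hB hm

theorem stmt_9 {V : Type*} [Fintype V] [DecidableEq V] (G : SimpleGraph V)
    [DecidableRel G.Adj] (hfree : ¬ ContainsDoubleStar G 3 3) (u v x : V)
    (huv : G.Adj u v) (hu : G.degree u = 6) (hv : G.degree v = 6)
    (hxu : G.Adj u x) (hxv : G.Adj v x) (hx : G.degree x = 4) :
    G.neighborFinset x ⊆ {u, v} ∪ (G.neighborFinset u ∩ G.neighborFinset v) := by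
  have hucard : ((G.neighborFinset u).erase v).card = 5 := by
    rw [Finset.card_erase_of_mem (by simpa using huv), G.card_neighborFinset_eq_degree, hu]
  have hvcard : ((G.neighborFinset v).erase u).card = 5 := by
    rw [Finset.card_erase_of_mem (by simpa using huv.symm), G.card_neighborFinset_eq_degree, hv]
  have hunion : ((G.neighborFinset u).erase v ∪ (G.neighborFinset v).erase u).card ≤ 5 := by
    by_contra! hlt
    exact hfree (containsDoubleStar_of_card_union huv (by omega) (by omega) hlt)
  have heq : (G.neighborFinset u).erase v = (G.neighborFinset v).erase u :=
    (Finset.eq_of_subset_of_card_le Finset.subset_union_left (hunion.trans hucard.ge)).trans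
      (Finset.eq_of_subset_of_card_le Finset.subset_union_right (hunion.trans hvcard.ge)).symm
  intro y hy
  rw [SimpleGraph.mem_neighborFinset] at hy
  by_contra hmem
  simp only [Finset.mem_union, Finset.mem_insert, Finset.mem_singleton, Finset.mem_inter,
    SimpleGraph.mem_neighborFinset, not_or, not_and] at hmem
  obtain ⟨⟨hyu, hyv⟩, hnot⟩ := hmem
  have hyu' : ¬ G.Adj u y := fun h => by
    have hmv : y ∈ (G.neighborFinset v).erase u := heq ▸ by simp [h, hyv]
    exact hnot h (by simpa [hyu] using hmv)
  refine hfree (containsDoubleStar_of_card_union hxu (by omega) (by omega) ?_)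
  have hsub : insert y ((G.neighborFinset u).erase x) ⊆
      (G.neighborFinset u).erase x ∪ (G.neighborFinset x).erase u := by
    refine Finset.insert_subset ?_ Finset.subset_union_left
    simp [hy, hyu]
  refine le_trans ?_ (Finset.card_le_card hsub)
  rw [Finset.card_insert_of_notMem (by simp [hyu']),
    Finset.card_erase_of_mem (by simpa using hxu), G.card_neighborFinset_eq_degree, hu]
end

section
/- Let G be an S_{3,3}-free simple graph, let u, v be adjacent vertices with d(u) = 6 and d(v) = 5, and let b be a neighbor of u with b ≠ v and b not adjacent to v. If d(b) ≥ 4, then every neighbor of b other than u is a common neighbor of u and v, i.e. N(b) ⊆ {u} ∪ (N(u) ∩ N(v)). -/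
/-- In an `S_{3,3}`-free graph, if `x` has degree at least `6` and its neighbor `y` has degree
at least `4`, then every neighbor of `y` other than `x` is a neighbor of `x`. -/
theorem adj_of_not_containsDoubleStar_s11 {V : Type*} [Fintype V] [DecidableEq V]
    (G : SimpleGraph V) [DecidableRel G.Adj] (hfree : ¬ ContainsDoubleStar G 3 3) {x y w : V}
    (hxy : G.Adj x y) (hx : 6 ≤ G.degree x) (hy : 4 ≤ G.degree y)
    (hyw : G.Adj y w) (hwx : w ≠ x) : G.Adj x w := by
  by_contra hxw
  have hX : 5 ≤ ((G.neighborFinset x).erase y).card := by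
    rw [Finset.card_erase_of_mem (by simpa using hxy), G.card_neighborFinset_eq_degree]
    omega
  have hY : 3 ≤ ((G.neighborFinset y).erase x).card := by
    rw [Finset.card_erase_of_mem (by simpa using hxy.symm), G.card_neighborFinset_eq_degree]
    omega
  obtain ⟨B, hwB, hBY, hB⟩ := Finset.exists_subsuperset_card_eq
    (s := {w}) (t := (G.neighborFinset y).erase x) (n := 3)
    (by simpa using ⟨hwx, hyw⟩) (by simp) hY
  have hinter : (B ∩ (G.neighborFinset x).erase y).card < 3 := by
    rw [← hB]
    refine Finset.card_lt_card (Finset.ssubset_iff_subset_ne.2 ⟨Finset.inter_subset_left, ?_⟩)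
    intro h
    have hw : w ∈ B ∩ (G.neighborFinset x).erase y := by
      rw [h]
      exact hwB (Finset.mem_singleton_self w)
    simp [hxw] at hw
  have hdiff : 3 ≤ ((G.neighborFinset x).erase y \ B).card := by
    rw [Finset.card_sdiff]
    omega
  obtain ⟨A, hA, hAcard⟩ := Finset.exists_subset_card_eq hdiff
  have hA' : ∀ a ∈ A, (a ≠ y ∧ G.Adj x a) ∧ a ∉ B := fun a ha => by simpa using hA ha
  have hB' : ∀ b ∈ B, b ≠ x ∧ G.Adj y b := fun b hb => by simpa using hBY hb
  exact hfree ⟨x, y, A, B, hxy, fun a ha => ⟨(hA' a ha).1.2, (hA' a ha).1.1⟩,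
    fun b hb => ⟨(hB' b hb).2, (hB' b hb).1⟩, hAcard, hB,
    Finset.disjoint_left.2 fun a ha => (hA' a ha).2,
    fun h => G.irrefl (hA' x h).1.2, fun h => (hB' x h).1 rfl,
    fun h => (hA' y h).1.1 rfl, fun h => G.irrefl (hB' y h).2⟩

theorem stmt_11 {V : Type*} [Fintype V] [DecidableEq V] (G : SimpleGraph V)
    [DecidableRel G.Adj] (hfree : ¬ ContainsDoubleStar G 3 3) (u v b : V)
    (huv : G.Adj u v) (hu : G.degree u = 6) (hv : G.degree v = 5)
    (hub : G.Adj u b) (hbv : b ≠ v) (hbv' : ¬ G.Adj b v) (hb : 4 ≤ G.degree b) :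
    G.neighborFinset b ⊆ {u} ∪ (G.neighborFinset u ∩ G.neighborFinset v) := by
  have hsub : (G.neighborFinset v).erase u ⊆ ((G.neighborFinset u).erase v).erase b := by
    intro w hw
    simp only [Finset.mem_erase, SimpleGraph.mem_neighborFinset] at hw ⊢
    refine ⟨?_, hw.2.ne', adj_of_not_containsDoubleStar_s11 G hfree huv (by omega) (by omega)
      hw.2 hw.1⟩
    rintro rfl
    exact hbv' hw.2.symm
  have heq := Finset.eq_of_subset_of_card_le hsub (by
    rw [Finset.card_erase_of_mem (by simp [hbv, hub]), Finset.card_erase_of_mem (by simpa),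
      Finset.card_erase_of_mem (by simpa using huv.symm), G.card_neighborFinset_eq_degree,
      G.card_neighborFinset_eq_degree, hu, hv])
  intro w hw
  rw [SimpleGraph.mem_neighborFinset] at hw
  by_cases hwu : w = u
  · simp [hwu]
  have huw := adj_of_not_containsDoubleStar_s11 G hfree hub (by omega) hb hw hwu
  have hwv : w ≠ v := by
    rintro rfl
    exact hbv' hw
  have hmem : w ∈ (G.neighborFinset v).erase u := by
    rw [heq]
    simp [hw.ne', hwv, huw]
  simp only [Finset.mem_erase, SimpleGraph.mem_neighborFinset] at hmem
  simp only [Finset.mem_union, Finset.mem_inter, SimpleGraph.mem_neighborFinset]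
  exact Or.inr ⟨huw, hmem.2⟩
end

section
/- Let G be an S_{3,3}-free simple graph, let u, v be adjacent vertices with d(u) = d(v) = 5 and |N(u) ∩ N(v)| ≥ 4, and let x be a common neighbor of u and v. Then x has at most one neighbor outside the set {u, v} ∪ (N(u) ∩ N(v)). -/
theorem stmt_12 {V : Type*} [Fintype V] [DecidableEq V] (G : SimpleGraph V)
    [DecidableRel G.Adj] (hfree : ¬ ContainsDoubleStar G 3 3) (u v x : V)
    (huv : G.Adj u v) (hu : G.degree u = 5) (hv : G.degree v = 5)
    (hcommon : 4 ≤ (G.neighborFinset u ∩ G.neighborFinset v).card)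
    (hxu : G.Adj u x) (hxv : G.Adj v x) :
    (G.neighborFinset x \ ({u, v} ∪ (G.neighborFinset u ∩ G.neighborFinset v))).card ≤ 1 := by
  -- Two such neighbors `T` would give the double star centered at `x`, `u` with leaves
  -- `insert v T` and three common neighbors of `u` and `v` other than `x`.
  by_contra! hcard
  obtain ⟨T, hT, hT2⟩ := Finset.exists_subset_card_eq hcard
  have hxC : x ∈ G.neighborFinset u ∩ G.neighborFinset v := by simp [hxu, hxv]
  have hC : 3 ≤ ((G.neighborFinset u ∩ G.neighborFinset v).erase x).card := by
    rw [Finset.card_erase_of_mem hxC]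
    omega
  obtain ⟨B, hB, hB3⟩ := Finset.exists_subset_card_eq hC
  have hT' : ∀ a ∈ T, G.Adj x a ∧ a ≠ u ∧ a ≠ v ∧ ¬ (G.Adj u a ∧ G.Adj v a) := by
    intro a ha
    have := hT ha
    simp only [Finset.mem_sdiff, Finset.mem_union, Finset.mem_insert, Finset.mem_singleton,
      Finset.mem_inter, SimpleGraph.mem_neighborFinset] at this
    tauto
  have hB' : ∀ b ∈ B, b ≠ x ∧ G.Adj u b ∧ G.Adj v b := by
    intro b hb
    simpa using hB hb
  have hvT : v ∉ T := fun h => (hT' v h).2.2.1 rfl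
  refine hfree ⟨x, u, insert v T, B, hxu.symm, ?_, fun b hb => ⟨(hB' b hb).2.1, (hB' b hb).1⟩,
    by rw [Finset.card_insert_of_notMem hvT, hT2], hB3, ?_, ?_, fun h => (hB' x h).1 rfl, ?_,
    fun h => G.irrefl (hB' u h).2.1⟩
  · intro a ha
    obtain rfl | ha := Finset.mem_insert.mp ha
    · exact ⟨hxv.symm, huv.ne'⟩
    · exact ⟨(hT' a ha).1, (hT' a ha).2.1⟩
  · rw [Finset.disjoint_left]
    intro a ha hb
    obtain rfl | ha := Finset.mem_insert.mp ha
    · exact G.irrefl (hB' a hb).2.2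
    · exact (hT' a ha).2.2.2 (hB' a hb).2
  · rw [Finset.mem_insert, not_or]
    exact ⟨hxv.ne', fun h => G.irrefl (hT' x h).1⟩
  · rw [Finset.mem_insert, not_or]
    exact ⟨huv.ne, fun h => (hT' u h).2.1 rfl⟩
end
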